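/- arXiv:2005.12377 — 8 statements merged into one kernel-verified Lean document; each statement's English description precedes it below -/
import Mathlib

section
/- For every λ ∈ ℝ, the line affineSpan ℝ {h(B,λ,A), h(B,λ,C)} is parallel (in the sense of AffineSubspace.Parallel) to the line affineSpan ℝ {h(D,λ,A), h(D,λ,C)}, and the line affineSpan ℝ {h(A,λ,B), h(A,λ,D)} is parallel to the line affineSpan ℝ {h(C,λ,B), h(C,λ,D)}. (Thus the four lines joining the homothetic images of the vertices form a parallelogram, called the homothetic parallelogram of ABCD with ratio λ.) -/
/-- The Euclidean plane. -/
noncomputable abbrev E : Type := EuclideanSpace ℝ (Fin 2)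

/-- `hmt P l Q` is the image of `Q` under the homothety with center `P` and ratio `l`. -/
noncomputable def hmt (P : E) (l : ℝ) (Q : E) : E := P + l • (Q - P)

/-- For every `λ ∈ ℝ`, the four lines joining the homothetic images of the vertices of a
quadrangle `ABCD` form a parallelogram: opposite lines are parallel. -/
theorem homothetic_parallelogram_sides_parallel (A B C D : E) (l : ℝ) :
    (affineSpan ℝ ({hmt B l A, hmt B l C} : Set E)).Parallel
      (affineSpan ℝ ({hmt D l A, hmt D l C} : Set E)) ∧
    (affineSpan ℝ ({hmt A l B, hmt A l D} : Set E)).Parallel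
      (affineSpan ℝ ({hmt C l B, hmt C l D} : Set E)) := by
  have key : ∀ P Q X Y : E,
      (affineSpan ℝ ({hmt P l X, hmt P l Y} : Set E)).Parallel
        (affineSpan ℝ ({hmt Q l X, hmt Q l Y} : Set E)) := by
    intro P Q X Y
    rw [AffineSubspace.affineSpan_pair_parallel_iff_vectorSpan_eq,
      vectorSpan_pair, vectorSpan_pair]
    have h : hmt P l X -ᵥ hmt P l Y = hmt Q l X -ᵥ hmt Q l Y := by
      simp only [hmt, vsub_eq_sub]
      module
    rw [h]
  exact ⟨key B D A C, key A C B D⟩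
end

section
/- For every λ ∈ ℝ there exist u, v ∈ ℝ such that K(λ) = h(A,λ,B) + u • (D − B) and K(λ) = h(B,λ,A) + v • (C − A); that is, K(λ) lies both on the line through h(A,λ,B) with direction D − B (the line through h(A,λ,B) and h(A,λ,D)) and on the line through h(B,λ,A) with direction C − A (the line through h(B,λ,A) and h(B,λ,C)). -/
/-- Vertex `K` of the homothetic parallelogram with ratio `l`
(intersection of the lines through the homothetic images near `A` and near `B`). -/
noncomputable def Kpt (A B O : E) (l : ℝ) : E := (1 - l) • (A + B) + (2 * l - 1) • O
/-- `K(λ)` lies both on the line through `h(A,λ,B)` with direction `D − B` and on the line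
through `h(B,λ,A)` with direction `C − A`. -/
theorem Kpt_mem_both_lines (A B C D O : E)
    (hind : LinearIndependent ℝ ![C - A, D - B])
    (hO₁ : O ∈ affineSpan ℝ ({A, C} : Set E))
    (hO₂ : O ∈ affineSpan ℝ ({B, D} : Set E)) (l : ℝ) :
    (∃ u : ℝ, Kpt A B O l = hmt A l B + u • (D - B)) ∧
    (∃ v : ℝ, Kpt A B O l = hmt B l A + v • (C - A)) := by
  have key : ∀ P Q : E, O ∈ affineSpan ℝ ({P, Q} : Set E) → ∃ t : ℝ, O = P + t • (Q - P) := by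
    intro P Q h
    obtain ⟨t, ht⟩ := mem_affineSpan_pair_iff_exists_lineMap_eq.1 h
    refine ⟨t, ?_⟩
    rw [← ht, AffineMap.lineMap_apply, vsub_eq_sub, vadd_eq_add, add_comm]
  obtain ⟨s, hs⟩ := key A C hO₁
  obtain ⟨t, ht⟩ := key B D hO₂
  constructor
  · refine ⟨(2 * l - 1) * t, ?_⟩
    rw [Kpt, hmt, ht]
    module
  · refine ⟨(2 * l - 1) * s, ?_⟩
    rw [Kpt, hmt, hs]
    module
end

section
/- For every λ ∈ ℝ and every point P ∈ E, if there exist u, v ∈ ℝ with P = h(A,λ,B) + u • (D − B) and P = h(B,λ,A) + v • (C − A), then P = K(λ); that is, K(λ) is the unique intersection point of the line through h(A,λ,B) with direction D − B and the line through h(B,λ,A) with direction C − A. -/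
/-- `K(λ)` is the unique intersection point of the line through `h(A,λ,B)` with direction
`D − B` and the line through `h(B,λ,A)` with direction `C − A`. -/
theorem Kpt_unique_intersection (A B C D O : E)
    (hind : LinearIndependent ℝ ![C - A, D - B])
    (hO₁ : O ∈ affineSpan ℝ ({A, C} : Set E))
    (hO₂ : O ∈ affineSpan ℝ ({B, D} : Set E)) (l : ℝ) (P : E)
    (hP : ∃ u v : ℝ, P = hmt A l B + u • (D - B) ∧ P = hmt B l A + v • (C - A)) :
    P = Kpt A B O l := by
  obtain ⟨u, v, h1, h2⟩ := hP
  rw [LinearIndependent.pair_iff] at hind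
  obtain ⟨s, hs⟩ := (mem_affineSpan_pair_iff_exists_lineMap_eq).1 hO₁
  obtain ⟨t, ht⟩ := (mem_affineSpan_pair_iff_exists_lineMap_eq).1 hO₂
  rw [AffineMap.lineMap_apply, vsub_eq_sub, vadd_eq_add] at hs ht
  rw [h1] at h2
  unfold hmt at h1 h2
  have key : (v - (2 * l - 1) * s) • (C - A) + (-(u - (2 * l - 1) * t)) • (D - B) = 0 := by
    have h3 : s • (C - A) = O - A := by rw [← hs]; abel
    have h4 : t • (D - B) = O - B := by rw [← ht]; abel
    have h5 : v • (C - A) = A + l • (B - A) + u • (D - B) - (B + l • (A - B)) := by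
      rw [h2]; abel
    rw [sub_smul, neg_smul, sub_smul, mul_smul, mul_smul, h3, h4, h5]
    module
  obtain ⟨-, hb⟩ := hind _ _ key
  have hu : u = (2 * l - 1) * t := by linarith
  have h4 : t • (D - B) = O - B := by rw [← ht]; abel
  rw [h1, hu, mul_smul, h4]
  unfold Kpt
  module
end

section
/- For λ ∈ ℝ let p(λ) = dist(K(λ), L(λ)) + dist(L(λ), M(λ)) + dist(M(λ), N(λ)) + dist(N(λ), K(λ)) be the perimeter of the homothetic parallelogram with ratio λ. Then p(λ) = 2 * |1 − λ| * (dist(A, C) + dist(B, D)) for every λ ∈ ℝ, and consequently p(λ₁) * |λ₂ − 1| = p(λ₂) * |λ₁ − 1| for all λ₁, λ₂ ∈ ℝ. -/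
/-- The perimeter of the homothetic parallelogram with ratio `l`. -/
noncomputable def perim (A B C D O : E) (l : ℝ) : ℝ :=
  dist (Kpt A B O l) (Kpt B C O l) + dist (Kpt B C O l) (Kpt C D O l) +
    dist (Kpt C D O l) (Kpt D A O l) + dist (Kpt D A O l) (Kpt A B O l)

/-- The perimeter of the homothetic parallelogram with ratio `λ` equals
`2 • |1 − λ| • (dist A C + dist B D)`, so perimeters of homothetic parallelograms are
proportional to `|λ − 1|`. -/
theorem homothetic_parallelogram_perimeter (A B C D O : E)
    (hind : LinearIndependent ℝ ![C - A, D - B])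
    (hO₁ : O ∈ affineSpan ℝ ({A, C} : Set E))
    (hO₂ : O ∈ affineSpan ℝ ({B, D} : Set E)) :
    (∀ l : ℝ, perim A B C D O l = 2 * |1 - l| * (dist A C + dist B D)) ∧
    (∀ l₁ l₂ : ℝ, perim A B C D O l₁ * |l₂ - 1| = perim A B C D O l₂ * |l₁ - 1|) := by
  have key : ∀ (P Q R : E) (l : ℝ),
      dist (Kpt P Q O l) (Kpt Q R O l) = |1 - l| * dist P R := by
    intro P Q R l
    have h : Kpt P Q O l - Kpt Q R O l = (1 - l) • (P - R) := by
      unfold Kpt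
      module
    rw [dist_eq_norm, h, norm_smul, Real.norm_eq_abs, dist_eq_norm]
  have main : ∀ l : ℝ, perim A B C D O l = 2 * |1 - l| * (dist A C + dist B D) := by
    intro l
    unfold perim
    rw [key, key, key, key, dist_comm C A, dist_comm D B]
    ring
  refine ⟨main, fun l₁ l₂ => ?_⟩
  rw [main, main, abs_sub_comm l₂ 1, abs_sub_comm l₁ 1]
  ring
end

section
/- For every λ ∈ ℝ, volume (convexHull ℝ {K(λ), L(λ), M(λ), N(λ)}) = ENNReal.ofReal (2 * (λ − 1)^2) * volume (convexHull ℝ {A, B, C, D}); that is, the area of the homothetic parallelogram with ratio λ equals 2(λ − 1)² times the area of the convex quadrangle ABCD. -/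
open MeasureTheory in
theorem aux_rect (a c b d s : ℝ) (h1 : a + c = 1) (h2 : b + d = 1) :
    volume (convexHull ℝ ({(-(a*s), -(b*s)), (c*s, -(b*s)), (c*s, d*s), (-(a*s), d*s)} : Set (ℝ × ℝ)))
      = ENNReal.ofReal (s ^ 2) := by
  have : ({(-(a*s), -(b*s)), (c*s, -(b*s)), (c*s, d*s), (-(a*s), d*s)} : Set (ℝ × ℝ))
      = ({-(a*s), c*s} : Set ℝ) ×ˢ ({-(b*s), d*s} : Set ℝ) := by
    ext ⟨x, y⟩
    simp only [Set.mem_insert_iff, Set.mem_singleton_iff, Set.mem_prod, Prod.mk.injEq]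
    tauto
  rw [this, convexHull_prod, convexHull_pair, convexHull_pair, segment_eq_uIcc, segment_eq_uIcc,
    Measure.volume_eq_prod, Measure.prod_prod, Real.volume_interval, Real.volume_interval,
    ← ENNReal.ofReal_mul (abs_nonneg _)]
  have e1 : c * s - -(a*s) = s := by linear_combination s * h1
  have e2 : d * s - -(b*s) = s := by linear_combination s * h2
  rw [e1, e2, abs_mul_abs_self, sq]

theorem aux_hull (a c b d : ℝ) (ha : 0 < a) (hc : 0 < c) (hb : 0 < b) (hd : 0 < d) :
    convexHull ℝ ({(-a, 0), (0, -b), (c, 0), (0, d)} : Set (ℝ × ℝ))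
      = {p | -(a * min (1 + p.2 / b) (1 - p.2 / d)) ≤ p.1 ∧
          p.1 ≤ c * min (1 + p.2 / b) (1 - p.2 / d)} := by
  have key : {p : ℝ × ℝ | -(a * min (1 + p.2 / b) (1 - p.2 / d)) ≤ p.1 ∧
          p.1 ≤ c * min (1 + p.2 / b) (1 - p.2 / d)}
      = {p | -p.1 / a - p.2 / b ≤ 1 ∧ -p.1 / a + p.2 / d ≤ 1 ∧ p.1 / c - p.2 / b ≤ 1 ∧
          p.1 / c + p.2 / d ≤ 1} := by
    ext ⟨x, y⟩
    have h1 : -(a * min (1 + y / b) (1 - y / d)) ≤ x ↔ -x / a ≤ min (1 + y / b) (1 - y / d) := by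
      rw [div_le_iff₀ ha]; constructor <;> intro h <;> linarith
    have h2 : x ≤ c * min (1 + y / b) (1 - y / d) ↔ x / c ≤ min (1 + y / b) (1 - y / d) := by
      rw [div_le_iff₀ hc]; constructor <;> intro h <;> linarith
    simp only [Set.mem_ofPred_eq, h1, h2, le_min_iff]
    constructor
    · rintro ⟨⟨_, _⟩, _, _⟩; refine ⟨?_, ?_, ?_, ?_⟩ <;> linarith
    · rintro ⟨_, _, _, _⟩; refine ⟨⟨?_, ?_⟩, ?_, ?_⟩ <;> linarith
  rw [key]
  apply Set.Subset.antisymm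
  · apply convexHull_min
    · rintro p hp
      simp only [Set.mem_insert_iff, Set.mem_singleton_iff] at hp
      have p1 : 0 < c / a := by positivity
      have p2 : 0 < a / c := by positivity
      have p3 : 0 < b / d := by positivity
      have p4 : 0 < d / b := by positivity
      rcases hp with rfl | rfl | rfl | rfl <;>
        simp [neg_div, ha.ne', hb.ne', hc.ne', hd.ne'] <;> (try constructor) <;> linarith
    · rintro ⟨x, y⟩ ⟨h1, h2, h3, h4⟩ ⟨x', y'⟩ ⟨h1', h2', h3', h4'⟩ s t hs ht hst
      simp only [Set.mem_ofPred_eq, Prod.smul_mk, Prod.mk_add_mk, smul_eq_mul] at *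
      have comb : ∀ u v : ℝ, u ≤ 1 → v ≤ 1 → s * u + t * v ≤ 1 := by
        intro u v hu hv; nlinarith
      refine ⟨?_, ?_, ?_, ?_⟩
      · convert comb _ _ h1 h1' using 1; ring
      · convert comb _ _ h2 h2' using 1; ring
      · convert comb _ _ h3 h3' using 1; ring
      · convert comb _ _ h4 h4' using 1; ring
  · rintro ⟨x, y⟩ ⟨h1, h2, h3, h4⟩
    simp only at h1 h2 h3 h4
    set H := convexHull ℝ ({(-a, 0), (0, -b), (c, 0), (0, d)} : Set (ℝ × ℝ)) with hH
    have hconv : Convex ℝ H := convex_convexHull ℝ _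
    have mA : ((-a, 0) : ℝ × ℝ) ∈ H := subset_convexHull ℝ _ (by simp)
    have mB : ((0, -b) : ℝ × ℝ) ∈ H := subset_convexHull ℝ _ (by simp)
    have mC : ((c, 0) : ℝ × ℝ) ∈ H := subset_convexHull ℝ _ (by simp)
    have mD : ((0, d) : ℝ × ℝ) ∈ H := subset_convexHull ℝ _ (by simp)
    have m0 : ((0, 0) : ℝ × ℝ) ∈ H := by
      have hac : 0 < a + c := by positivity
      have := hconv mA mC (a := c / (a + c)) (b := a / (a + c)) (by positivity) (by positivity)
        (by field_simp; ring)
      convert this using 1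
      ext
      · simp; field_simp; ring
      · simp
    have tri : ∀ (p q : ℝ × ℝ) (u v : ℝ), p ∈ H → q ∈ H → 0 ≤ u → 0 ≤ v → u + v ≤ 1 →
        u • p + v • q ∈ H := by
      intro p q u v hp hq hu hv huv
      rcases (add_nonneg hu hv).eq_or_lt with h | h
      · have hu0 : u = 0 := by linarith
        have hv0 : v = 0 := by linarith
        subst hu0; subst hv0
        rw [zero_smul, zero_smul, add_zero]
        exact m0
      · have h1 := hconv hp hq (a := u / (u + v)) (b := v / (u + v)) (by positivity)
          (by positivity) (by field_simp)
        have h2 := hconv m0 h1 (a := 1 - (u + v)) (b := u + v) (by linarith) h.le (by ring)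
        convert h2 using 1
        ext
        · simp; field_simp
        · simp; field_simp
    rcases le_total 0 x with hx | hx <;> rcases le_total 0 y with hy | hy
    · convert tri _ _ (x / c) (y / d) mC mD (by positivity) (by positivity) h4 using 1
      ext <;> simp <;> field_simp
    · convert tri _ _ (x / c) (-y / b) mC mB (by positivity)
        (div_nonneg (by linarith) hb.le) (by rw [neg_div]; linarith) using 1
      ext <;> simp <;> field_simp
    · convert tri _ _ (-x / a) (y / d) mA mD (div_nonneg (by linarith) ha.le) (by positivity)
        h2 using 1
      ext <;> simp <;> field_simp
    · convert tri _ _ (-x / a) (-y / b) mA mB (div_nonneg (by linarith) ha.le)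
        (div_nonneg (by linarith) hb.le) (by rw [neg_div b y]; linarith) using 1
      ext <;> simp <;> field_simp

open MeasureTheory in
theorem aux_lint (b d : ℝ) (hb : 0 < b) (hd : 0 < d) (h : b + d = 1) :
    ∫⁻ y : ℝ, ENNReal.ofReal (min (1 + y / b) (1 - y / d)) = ENNReal.ofReal (1 / 2) := by
  have hz : ∀ y ∉ Set.Ioc (-b) d, ENNReal.ofReal (min (1 + y / b) (1 - y / d)) = 0 := by
    intro y hy
    rw [ENNReal.ofReal_eq_zero, min_le_iff]
    rcases le_or_gt y (-b) with h | h
    · left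
      have : y / b ≤ -1 := by rw [div_le_iff₀ hb]; linarith
      linarith
    · right
      have : 1 ≤ y / d := by
        rw [le_div_iff₀ hd]
        by_contra h'
        exact hy ⟨h, by linarith⟩
      linarith
  have hcont : Continuous fun y : ℝ => min (1 + y / b) (1 - y / d) := by fun_prop
  rw [← setLIntegral_eq_of_support_subset (s := Set.Ioc (-b) d)]
  rotate_left
  · intro y hy
    by_contra h'
    exact hy (hz y h')
  rw [← ofReal_integral_eq_lintegral_ofReal]
  · congr 1
    rw [← intervalIntegral.integral_of_le (by linarith),
      ← intervalIntegral.integral_add_adjacent_intervals (b := 0)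
        (hcont.intervalIntegrable _ _) (hcont.intervalIntegrable _ _)]
    have e1 : ∫ y in (-b)..0, min (1 + y / b) (1 - y / d) = ∫ y in (-b)..0, (1 + y / b) := by
      apply intervalIntegral.integral_congr
      intro y hy
      rw [Set.uIcc_of_le (by linarith)] at hy
      have t1 : y / b ≤ 0 := div_nonpos_of_nonpos_of_nonneg hy.2 hb.le
      have t2 : y / d ≤ 0 := div_nonpos_of_nonpos_of_nonneg hy.2 hd.le
      exact min_eq_left (by linarith)
    have e2 : ∫ y in (0:ℝ)..d, min (1 + y / b) (1 - y / d) = ∫ y in (0:ℝ)..d, (1 - y / d) := by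
      apply intervalIntegral.integral_congr
      intro y hy
      rw [Set.uIcc_of_le (by linarith)] at hy
      have t1 : 0 ≤ y / b := div_nonneg hy.1 hb.le
      have t2 : 0 ≤ y / d := div_nonneg hy.1 hd.le
      exact min_eq_right (by linarith)
    rw [e1, e2, intervalIntegral.integral_add (by simp)
      (Continuous.intervalIntegrable (by fun_prop) _ _),
      intervalIntegral.integral_sub (by simp) (Continuous.intervalIntegrable (by fun_prop) _ _)]
    simp
    field_simp
    linarith
  · exact (hcont.integrableOn_Icc).mono_set Set.Ioc_subset_Icc_self
  · filter_upwards [ae_restrict_mem measurableSet_Ioc] with y hy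
    have t1 : -1 ≤ y / b := by rw [le_div_iff₀ hb]; linarith [hy.1]
    have t2 : y / d ≤ 1 := by rw [div_le_iff₀ hd]; linarith [hy.2]
    show (0:ℝ) ≤ min (1 + y / b) (1 - y / d)
    exact le_min (by linarith) (by linarith)

open MeasureTheory in
theorem aux_quad (a c b d : ℝ) (ha : 0 < a) (hc : 0 < c) (hb : 0 < b) (hd : 0 < d)
    (h1 : a + c = 1) (h2 : b + d = 1) :
    volume (convexHull ℝ ({(-a, 0), (0, -b), (c, 0), (0, d)} : Set (ℝ × ℝ)))
      = ENNReal.ofReal (1 / 2) := by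
  rw [aux_hull a c b d ha hc hb hd, ← aux_lint b d hb hd h2, Measure.volume_eq_prod,
    Measure.prod_apply_symm]
  · apply lintegral_congr
    intro y
    have : ((fun x : ℝ => (x, y)) ⁻¹' {p : ℝ × ℝ | -(a * min (1 + p.2 / b) (1 - p.2 / d)) ≤ p.1 ∧
          p.1 ≤ c * min (1 + p.2 / b) (1 - p.2 / d)})
        = Set.Icc (-(a * min (1 + y / b) (1 - y / d))) (c * min (1 + y / b) (1 - y / d)) := rfl
    rw [this, Real.volume_Icc]
    congr 1
    linear_combination (min (1 + y / b) (1 - y / d)) * h1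
  · apply IsClosed.measurableSet
    apply IsClosed.and
    · exact isClosed_le (by fun_prop) (by fun_prop)
    · exact isClosed_le (by fun_prop) (by fun_prop)

open MeasureTheory Pointwise in
theorem aux_map (O u v : E) (hind : LinearIndependent ℝ ![u, v]) :
    ∃ κ : ENNReal, ∀ S : Set (ℝ × ℝ),
      volume (convexHull ℝ ((fun p : ℝ × ℝ => O + (p.1 • u + p.2 • v)) '' S))
        = κ * volume (convexHull ℝ S) := by
  let L : (ℝ × ℝ) →ₗ[ℝ] E :=
    (LinearMap.fst ℝ ℝ ℝ).smulRight u + (LinearMap.snd ℝ ℝ ℝ).smulRight v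
  have hL : ∀ p, L p = p.1 • u + p.2 • v := fun p => rfl
  have hinj : Function.Injective L := by
    rw [injective_iff_map_eq_zero]
    rintro ⟨x, y⟩ h
    have := LinearIndependent.pair_iff.mp hind x y h
    simp [this.1, this.2]
  let e : (ℝ × ℝ) ≃L[ℝ] E :=
    (LinearEquiv.ofInjectiveOfFinrankEq L hinj (by simp)).toContinuousLinearEquiv
  have he : ∀ p, e p = p.1 • u + p.2 • v := fun p => rfl
  have hμ : (Measure.map e.symm (volume : Measure E)).IsAddHaarMeasure := inferInstance
  refine ⟨(Measure.addHaarScalarFactor (Measure.map e.symm (volume : Measure E))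
    (volume : Measure (ℝ × ℝ)) : NNReal), fun S => ?_⟩
  have hS : ((fun p : ℝ × ℝ => O + (p.1 • u + p.2 • v)) '' S) = O +ᵥ (e.toLinearMap '' S) := by
    rw [← Set.image_vadd, Set.image_image]
    rfl
  rw [hS, convexHull_vadd, measure_vadd, ← LinearMap.image_convexHull]
  have h3 := Measure.isAddLeftInvariant_eq_smul (Measure.map e.symm (volume : Measure E))
    (volume : Measure (ℝ × ℝ))
  have h4 : volume (e.toLinearMap '' convexHull ℝ S)
      = Measure.map e.symm (volume : Measure E) (convexHull ℝ S) := by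
    have : (e.symm : E → ℝ × ℝ) = e.symm.toHomeomorph.toMeasurableEquiv := rfl
    rw [this, MeasurableEquiv.map_apply]
    congr 1
    exact e.toEquiv.image_eq_preimage_symm _
  rw [h4]
  exact congrArg (fun m : Measure (ℝ × ℝ) => m (convexHull ℝ S)) h3

open MeasureTheory in
/-- The area of the homothetic parallelogram with ratio `λ` of a convex quadrangle `ABCD`
equals `2(λ − 1)²` times the area of the quadrangle. -/
theorem homothetic_parallelogram_area (A B C D O : E)
    (hind : LinearIndependent ℝ ![C - A, D - B])
    (hO₁ : O ∈ openSegment ℝ A C) (hO₂ : O ∈ openSegment ℝ B D) (l : ℝ) :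
    volume (convexHull ℝ ({Kpt A B O l, Kpt B C O l, Kpt C D O l, Kpt D A O l} : Set E)) =
      ENNReal.ofReal (2 * (l - 1) ^ 2) * volume (convexHull ℝ ({A, B, C, D} : Set E)) := by
  obtain ⟨c, a, hc, ha, hac, hO1⟩ := hO₁
  obtain ⟨d, b, hd, hb, hbd, hO2⟩ := hO₂
  obtain ⟨κ, hκ⟩ := aux_map O (C - A) (D - B) hind
  have hc' : c = 1 - a := by linarith
  have hd' : d = 1 - b := by linarith
  have eA : A = O - a • (C - A) := by rw [← hO1, hc']; module
  have eC : C = O + c • (C - A) := by rw [← hO1, hc']; module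
  have eB : B = O - b • (D - B) := by rw [← hO2, hd']; module
  have eD : D = O + d • (D - B) := by rw [← hO2, hd']; module
  have q := hκ {(-a, 0), (0, -b), (c, 0), (0, d)}
  have r := hκ {(-(a*(1-l)), -(b*(1-l))), (c*(1-l), -(b*(1-l))), (c*(1-l), d*(1-l)),
    (-(a*(1-l)), d*(1-l))}
  rw [aux_quad a c b d ha hc hb hd (by linarith) (by linarith)] at q
  rw [aux_rect a c b d _ (by linarith) (by linarith)] at r
  simp only [Set.image_insert_eq, Set.image_singleton] at q r
  generalize C - A = u at *
  generalize D - B = v at *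
  have q' : ({A, B, C, D} : Set E) = {O + ((-a) • u + (0:ℝ) • v), O + ((0:ℝ) • u + (-b) • v),
      O + (c • u + (0:ℝ) • v), O + ((0:ℝ) • u + d • v)} := by
    have pA : O + ((-a) • u + (0:ℝ) • v) = A := by rw [eA]; module
    have pB : O + ((0:ℝ) • u + (-b) • v) = B := by rw [eB]; module
    have pC : O + (c • u + (0:ℝ) • v) = C := by rw [eC]; module
    have pD : O + ((0:ℝ) • u + d • v) = D := by rw [eD]; module
    rw [pA, pB, pC, pD]
  have k1 : Kpt A B O l = O + ((-(a*(1-l))) • u + (-(b*(1-l))) • v) := by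
    rw [Kpt, eA, eB]; module
  have k2 : Kpt B C O l = O + ((c*(1-l)) • u + (-(b*(1-l))) • v) := by
    rw [Kpt, eB, eC]; module
  have k3 : Kpt C D O l = O + ((c*(1-l)) • u + (d*(1-l)) • v) := by
    rw [Kpt, eC, eD]; module
  have k4 : Kpt D A O l = O + ((-(a*(1-l))) • u + (d*(1-l)) • v) := by
    rw [Kpt, eD, eA]; module
  rw [q', q, k1, k2, k3, k4, r, mul_left_comm, ← ENNReal.ofReal_mul (by positivity)]
  congr 2
  ring
end

section
/- volume (convexHull ℝ {A, B, C, D}) = ENNReal.ofReal ((1/2) * |(C − A) 0 * (D − B) 1 − (C − A) 1 * (D − B) 0|); that is, the area of a convex quadrangle equals half the absolute value of the determinant of its diagonal vectors C − A and D − B. -/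
open MeasureTheory in
theorem lintegral_tent (s : ℝ) (h0 : 0 < s) (h1 : s < 1) :
    ∫⁻ x : ℝ, ENNReal.ofReal (min (1 + x / s) (1 - x / (1 - s))) = ENNReal.ofReal (1 / 2) := by
  have h1' : 0 < 1 - s := by linarith
  set h : ℝ → ℝ := fun x => min (1 + x / s) (1 - x / (1 - s)) with hh
  have hc : Continuous h := by
    have : Continuous fun x : ℝ => x / s := continuous_id.div_const s
    have : Continuous fun x : ℝ => x / (1 - s) := continuous_id.div_const _
    fun_prop
  have e1 : ∀ x, x ≤ 0 → h x = 1 + x / s := by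
    intro x hx
    have a1 := div_nonpos_of_nonpos_of_nonneg hx h0.le
    have a2 := div_nonpos_of_nonpos_of_nonneg hx h1'.le
    have : x / s ≤ 0 := a1
    exact min_eq_left (by linarith)
  have e2 : ∀ x, 0 ≤ x → h x = 1 - x / (1 - s) := by
    intro x hx
    have a1 : 0 ≤ x / s := by positivity
    have a2 : 0 ≤ x / (1 - s) := by positivity
    exact min_eq_right (by linarith)
  have hout : ∀ x, x ∉ Set.Ioc (-s) (1 - s) → h x ≤ 0 := by
    intro x hx
    rw [Set.mem_Ioc, not_and_or, not_lt, not_le] at hx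
    rcases hx with hx | hx
    · refine (min_le_left _ _).trans ?_
      have : x / s ≤ -1 := by rw [div_le_iff₀ h0]; linarith
      linarith
    · refine (min_le_right _ _).trans ?_
      have : 1 ≤ x / (1 - s) := by rw [le_div_iff₀ h1']; linarith
      linarith
  have hin : ∀ x, x ∈ Set.Ioc (-s) (1 - s) → 0 ≤ h x := by
    rintro x ⟨hx1, hx2⟩
    refine le_min ?_ ?_
    · have : -1 ≤ x / s := by rw [le_div_iff₀ h0]; linarith
      linarith
    · have : x / (1 - s) ≤ 1 := by rw [div_le_iff₀ h1']; linarith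
      linarith
  have hr : ∫⁻ x : ℝ, ENNReal.ofReal (h x) =
      ∫⁻ x in Set.Ioc (-s) (1 - s), ENNReal.ofReal (h x) := by
    rw [← lintegral_indicator measurableSet_Ioc]
    congr 1
    ext x
    by_cases hx : x ∈ Set.Ioc (-s) (1 - s)
    · simp only [Set.indicator_of_mem hx]
    · simp only [Set.indicator_of_notMem hx, ENNReal.ofReal_eq_zero]
      exact hout x hx
  have hi : ∀ a b : ℝ, IntervalIntegrable h volume a b := fun a b => hc.intervalIntegrable a b
  have hI : IntegrableOn h (Set.Ioc (-s) (1 - s)) := by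
    have := hi (-s) (1 - s)
    rwa [intervalIntegrable_iff_integrableOn_Ioc_of_le (by linarith)] at this
  rw [hr, ← ofReal_integral_eq_lintegral_ofReal hI
    ((ae_restrict_iff' measurableSet_Ioc).2 (ae_of_all _ hin)),
    ← intervalIntegral.integral_of_le (by linarith),
    ← intervalIntegral.integral_add_adjacent_intervals (hi (-s) 0) (hi 0 (1 - s))]
  have i1 : ∫ x in (-s)..0, h x = ∫ x in (-s)..0, (1 + x / s) := by
    apply intervalIntegral.integral_congr
    intro x hx
    rw [Set.uIcc_of_le (by linarith)] at hx
    exact e1 x hx.2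
  have i2 : ∫ x in 0..(1 - s), h x = ∫ x in 0..(1 - s), (1 - x / (1 - s)) := by
    apply intervalIntegral.integral_congr
    intro x hx
    rw [Set.uIcc_of_le (by linarith)] at hx
    exact e2 x hx.1
  have ii : ∀ c a b : ℝ, IntervalIntegrable (fun x => x / c) volume a b := fun c a b =>
    (continuous_id.div_const c).intervalIntegrable a b
  rw [i1, i2, intervalIntegral.integral_add (by simp) (ii _ _ _),
    intervalIntegral.integral_sub (by simp) (ii _ _ _)]
  simp only [intervalIntegral.integral_div, integral_id, intervalIntegral.integral_const]
  congr 1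
  simp only [smul_eq_mul]
  field_simp
  ring

/-- The model quadrangle. -/
def modelQ (s t : ℝ) : Set E :=
  {p | -t * min (1 + p 0 / s) (1 - p 0 / (1 - s)) ≤ p 1 ∧
    p 1 ≤ (1 - t) * min (1 + p 0 / s) (1 - p 0 / (1 - s))}

open MeasureTheory in
theorem volume_modelQ (s t : ℝ) (h0 : 0 < s) (h1 : s < 1) :
    volume (modelQ s t) = ENNReal.ofReal (1 / 2) := by
  set h : ℝ → ℝ := fun x => min (1 + x / s) (1 - x / (1 - s)) with hh
  have hc : Continuous h := by
    have : Continuous fun x : ℝ => x / s := continuous_id.div_const s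
    have : Continuous fun x : ℝ => x / (1 - s) := continuous_id.div_const _
    fun_prop
  let T : Set (ℝ × ℝ) := {q | -t * h q.1 ≤ q.2 ∧ q.2 ≤ (1 - t) * h q.1}
  have hT : MeasurableSet T := by
    apply IsClosed.measurableSet
    have c1 : IsClosed {q : ℝ × ℝ | -t * h q.1 ≤ q.2} := isClosed_le (by fun_prop) (by fun_prop)
    have c2 : IsClosed {q : ℝ × ℝ | q.2 ≤ (1 - t) * h q.1} :=
      isClosed_le (by fun_prop) (by fun_prop)
    exact c1.inter c2
  have m : MeasurePreserving (fun p : E => (p 0, p 1)) volume volume :=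
    (volume_preserving_finTwoArrow ℝ).comp (PiLp.volume_preserving_ofLp (Fin 2))
  have : modelQ s t = (fun p : E => (p 0, p 1)) ⁻¹' T := rfl
  rw [this, m.measure_preimage hT.nullMeasurableSet, Measure.volume_eq_prod,
    Measure.prod_apply hT, ← lintegral_tent s h0 h1]
  congr 1
  ext x
  have : Prod.mk x ⁻¹' T = Set.Icc (-t * h x) ((1 - t) * h x) := rfl
  rw [this, Real.volume_Icc]
  congr 1
  simp only [hh]
  ring

theorem mem_modelQ (s t : ℝ) (h0 : 0 < s) (h1 : s < 1) (k0 : 0 < t) (k1 : t < 1) (p : E) :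
    p ∈ modelQ s t ↔ (-p 1 / t ≤ 1 + p 0 / s ∧ -p 1 / t ≤ 1 - p 0 / (1 - s)) ∧
      (p 1 / (1 - t) ≤ 1 + p 0 / s ∧ p 1 / (1 - t) ≤ 1 - p 0 / (1 - s)) := by
  have k1' : 0 < 1 - t := by linarith
  rw [← le_min_iff, ← le_min_iff, div_le_iff₀ k0, div_le_iff₀ k1']
  unfold modelQ
  simp only [Set.mem_ofPred_eq]
  constructor <;> rintro ⟨a, b⟩ <;> constructor <;> nlinarith

theorem convex_modelQ (s t : ℝ) (h0 : 0 < s) (h1 : s < 1) (k0 : 0 < t) (k1 : t < 1) :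
    Convex ℝ (modelQ s t) := by
  intro p hp q hq a b ha hb hab
  rw [mem_modelQ s t h0 h1 k0 k1] at *
  obtain ⟨⟨p1, p2⟩, p3, p4⟩ := hp
  obtain ⟨⟨q1, q2⟩, q3, q4⟩ := hq
  simp only [PiLp.add_apply, PiLp.smul_apply, smul_eq_mul]
  have hb' : b = 1 - a := by linarith
  have key : ∀ {x y z w : ℝ}, x ≤ y → z ≤ w → a * x + b * z ≤ a * y + b * w := by
    intro x y z w h h'
    gcongr
  refine ⟨⟨?_, ?_⟩, ?_, ?_⟩
  · convert key p1 q1 using 1 <;> subst hb' <;> ring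
  · convert key p2 q2 using 1 <;> subst hb' <;> ring
  · convert key p3 q3 using 1 <;> subst hb' <;> ring
  · convert key p4 q4 using 1 <;> subst hb' <;> ring

/-- Triangle membership. -/
theorem tri_mem {K : Set E} (hK : Convex ℝ K) {O P Q : E} (hO : O ∈ K) (hP : P ∈ K) (hQ : Q ∈ K)
    {a b : ℝ} (ha : 0 ≤ a) (hb : 0 ≤ b) (hab : a + b ≤ 1) :
    O + (a • (P - O) + b • (Q - O)) ∈ K := by
  have h := hK.sum_mem (t := Finset.univ) (w := ![1 - a - b, a, b]) (z := ![O, P, Q])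
    (by intro i _; fin_cases i <;> simp <;> linarith)
    (by simp [Fin.sum_univ_three]; ring)
    (by intro i _; fin_cases i <;> simp [hO, hP, hQ])
  convert h using 1
  simp only [Fin.sum_univ_three, Matrix.cons_val_zero, Matrix.cons_val_one, Matrix.cons_val]
  module

open MeasureTheory in
/-- The area of a convex quadrangle `ABCD` equals half the absolute value of the determinant
of its diagonal vectors `C − A` and `D − B`. -/
theorem area_convex_quadrangle (A B C D O : E)
    (hind : LinearIndependent ℝ ![C - A, D - B])
    (hO₁ : O ∈ openSegment ℝ A C) (hO₂ : O ∈ openSegment ℝ B D) :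
    volume (convexHull ℝ ({A, B, C, D} : Set E)) =
      ENNReal.ofReal ((1 / 2) * |(C - A) 0 * (D - B) 1 - (C - A) 1 * (D - B) 0|) := by
  have hOK : O ∈ convexHull ℝ ({A, B, C, D} : Set E) :=
    (convex_convexHull ℝ _).openSegment_subset (subset_convexHull ℝ _ (by simp))
      (subset_convexHull ℝ _ (by simp)) hO₁
  rw [openSegment_eq_image] at hO₁ hO₂
  obtain ⟨s, ⟨h0, h1⟩, hs⟩ := hO₁
  obtain ⟨t, ⟨k0, k1⟩, ht⟩ := hO₂
  simp only at hs ht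
  have h1' : 0 < 1 - s := by linarith
  have k1' : 0 < 1 - t := by linarith
  set u := C - A with hu
  set v := D - B with hv
  have hA : A - O = (-s) • u := by rw [← hs, hu]; module
  have hC : C - O = (1 - s) • u := by rw [← hs, hu]; module
  have hB : B - O = (-t) • v := by rw [← ht, hv]; module
  have hD : D - O = (1 - t) • v := by rw [← ht, hv]; module
  let b := (EuclideanSpace.basisFun (Fin 2) ℝ).toBasis
  let M : Matrix (Fin 2) (Fin 2) ℝ := !![u 0, v 0; u 1, v 1]
  let L : E →ₗ[ℝ] E := Matrix.toLin b b M
  have hdet : LinearMap.det L = u 0 * v 1 - u 1 * v 0 := by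
    rw [LinearMap.det_toLin, Matrix.det_fin_two_of]; ring
  have hL : ∀ p : E, L p = p 0 • u + p 1 • v := by
    intro p
    have : L p = Matrix.toEuclideanLin M p := by
      rw [Matrix.toEuclideanLin_eq_toLin_orthonormal]
    rw [this]
    ext i
    fin_cases i <;> simp [M, Matrix.toEuclideanLin, Matrix.mulVec, dotProduct] <;> ring
  have himg : convexHull ℝ ({A, B, C, D} : Set E) = (fun x => O + x) '' (L '' modelQ s t) := by
    apply Set.Subset.antisymm
    · apply convexHull_min
      · have mem : ∀ (P : E) (x y : ℝ), P - O = x • u + y • v → !₂[x, y] ∈ modelQ s t →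
            P ∈ (fun x => O + x) '' (L '' modelQ s t) := by
          intro P x y h hm
          refine ⟨_, ⟨_, hm, rfl⟩, ?_⟩
          simp only [hL]
          simp [← h]
        have e1 : s / s = 1 := div_self h0.ne'
        have e2 : t / t = 1 := div_self k0.ne'
        have e3 : (1 - s) / (1 - s) = 1 := div_self h1'.ne'
        have e4 : (1 - t) / (1 - t) = 1 := div_self k1'.ne'
        have f1 : 0 < s / (1 - s) := by positivity
        have f2 : 0 < t / (1 - t) := by positivity
        have f3 : 0 < (1 - s) / s := by positivity
        have f4 : 0 < (1 - t) / t := by positivity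
        rintro P (rfl | rfl | rfl | rfl)
        · apply mem _ (-s) 0 (by rw [hA]; simp)
          rw [mem_modelQ s t h0 h1 k0 k1]
          simp [neg_div, e1, e2, e3, e4]; linarith
        · apply mem _ 0 (-t) (by rw [hB]; simp)
          rw [mem_modelQ s t h0 h1 k0 k1]
          simp [neg_div, e1, e2, e3, e4]; linarith
        · apply mem _ (1 - s) 0 (by rw [hC]; simp)
          rw [mem_modelQ s t h0 h1 k0 k1]
          simp [e1, e2, e3, e4]; linarith
        · apply mem _ 0 (1 - t) (by rw [hD]; simp)
          rw [mem_modelQ s t h0 h1 k0 k1]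
          simp only [neg_div]
          simp [neg_div, e1, e2, e3, e4, -neg_sub]; linarith
      · exact ((convex_modelQ s t h0 h1 k0 k1).linear_image L).translate O
    · rintro _ ⟨_, ⟨p, hp, rfl⟩, rfl⟩
      rw [mem_modelQ s t h0 h1 k0 k1] at hp
      obtain ⟨⟨p1, p2⟩, p3, p4⟩ := hp
      have hK := convex_convexHull ℝ ({A, B, C, D} : Set E)
      have mA : A ∈ convexHull ℝ ({A, B, C, D} : Set E) := subset_convexHull ℝ _ (by simp)
      have mB : B ∈ convexHull ℝ ({A, B, C, D} : Set E) := subset_convexHull ℝ _ (by simp)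
      have mC : C ∈ convexHull ℝ ({A, B, C, D} : Set E) := subset_convexHull ℝ _ (by simp)
      have mD : D ∈ convexHull ℝ ({A, B, C, D} : Set E) := subset_convexHull ℝ _ (by simp)
      have g1 : p 0 = (-p 0 / s) * (-s) := by field_simp
      have g2 : p 0 = (p 0 / (1 - s)) * (1 - s) := by field_simp
      have g3 : p 1 = (-p 1 / t) * (-t) := by field_simp
      have g4 : p 1 = (p 1 / (1 - t)) * (1 - t) := by field_simp
      have n1 : -p 0 / s = - (p 0 / s) := neg_div _ _
      simp only [hL]
      rcases le_total 0 (p 0) with hx | hx <;> rcases le_total 0 (p 1) with hy | hy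
      · have := tri_mem hK hOK mC mD (a := p 0 / (1 - s)) (b := p 1 / (1 - t))
          (by positivity) (by positivity) (by linarith)
        rwa [hC, hD, smul_smul, smul_smul, ← g2, ← g4] at this
      · have := tri_mem hK hOK mC mB (a := p 0 / (1 - s)) (b := -p 1 / t)
          (by positivity) (div_nonneg (by linarith) k0.le) (by linarith)
        rwa [hC, hB, smul_smul, smul_smul, ← g2, ← g3] at this
      · have := tri_mem hK hOK mA mD (a := -p 0 / s) (b := p 1 / (1 - t))
          (div_nonneg (by linarith) h0.le) (by positivity) (by linarith)
        rwa [hA, hD, smul_smul, smul_smul, ← g1, ← g4] at this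
      · have := tri_mem hK hOK mA mB (a := -p 0 / s) (b := -p 1 / t)
          (div_nonneg (by linarith) h0.le) (div_nonneg (by linarith) k0.le) (by linarith)
        rwa [hA, hB, smul_smul, smul_smul, ← g1, ← g3] at this
  rw [himg, Set.image_add_left, measure_preimage_add, Measure.addHaar_image_linearMap, hdet,
    volume_modelQ s t h0 h1, ← ENNReal.ofReal_mul (abs_nonneg _), mul_comm]
end

section
/- (Wittenbauer's theorem) The lines joining the trisection points of the sides adjacent to each vertex form a parallelogram: the line affineSpan ℝ {A + (1/3) • (B − A), A + (1/3) • (D − A)} is parallel (in the sense of AffineSubspace.Parallel) to the line affineSpan ℝ {C + (1/3) • (B − C), C + (1/3) • (D − C)}, and the line affineSpan ℝ {B + (1/3) • (A − B), B + (1/3) • (C − B)} is parallel to the line affineSpan ℝ {D + (1/3) • (A − D), D + (1/3) • (C − D)}. -/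
/-- **Wittenbauer's theorem**: the lines joining the trisection points of the sides adjacent
to each vertex of a quadrangle form a parallelogram. -/
theorem wittenbauer (A B C D : E) :
    (affineSpan ℝ ({A + (1 / 3 : ℝ) • (B - A), A + (1 / 3 : ℝ) • (D - A)} : Set E)).Parallel
      (affineSpan ℝ ({C + (1 / 3 : ℝ) • (B - C), C + (1 / 3 : ℝ) • (D - C)} : Set E)) ∧
    (affineSpan ℝ ({B + (1 / 3 : ℝ) • (A - B), B + (1 / 3 : ℝ) • (C - B)} : Set E)).Parallel
      (affineSpan ℝ ({D + (1 / 3 : ℝ) • (A - D), D + (1 / 3 : ℝ) • (C - D)} : Set E)) := by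
  constructor <;>
  · rw [AffineSubspace.affineSpan_pair_parallel_iff_vectorSpan_eq, vectorSpan_pair,
      vectorSpan_pair]
    congr 2
    simp only [vsub_eq_sub]
    module
end

section
/- (Area of Wittenbauer's parallelogram) volume (convexHull ℝ {K(1/3), L(1/3), M(1/3), N(1/3)}) = ENNReal.ofReal (8/9) * volume (convexHull ℝ {A, B, C, D}); that is, Wittenbauer's parallelogram of a convex quadrangle (the homothetic parallelogram with ratio 1/3) has area 8/9 of the quadrangle. -/
open MeasureTheory

lemma aux_comb {S : Set (ℝ × ℝ)} (hS : Convex ℝ S) (h0 : (0 : ℝ × ℝ) ∈ S) {P Q : ℝ × ℝ}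
    (hP : P ∈ S) (hQ : Q ∈ S) {a b : ℝ} (ha : 0 ≤ a) (hb : 0 ≤ b) (hab : a + b ≤ 1) :
    a • P + b • Q ∈ S := by
  have h := hS.sum_mem (t := Finset.univ) (w := ![a, b, 1 - a - b]) (z := ![P, Q, 0])
    (by intro i _; fin_cases i <;> simp <;> linarith)
    (by simp [Fin.sum_univ_three])
    (by intro i _; fin_cases i <;> simp [hP, hQ, h0])
  simpa [Fin.sum_univ_three] using h

lemma aux_hull_s18 {u v s t : ℝ} (hu : 0 < u) (hv : 0 < v) (hs : 0 < s) (ht : 0 < t) :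
    convexHull ℝ ({(-v, 0), (0, -t), (u, 0), (0, s)} : Set (ℝ × ℝ)) =
      {p | -t * min (1 + p.1 / v) (1 - p.1 / u) ≤ p.2 ∧
        p.2 ≤ s * min (1 + p.1 / v) (1 - p.1 / u)} := by
  have key : ∀ x : ℝ × ℝ, (-t * min (1 + x.1 / v) (1 - x.1 / u) ≤ x.2 ∧
        x.2 ≤ s * min (1 + x.1 / v) (1 - x.1 / u)) ↔
      (-(x.2 / t) ≤ 1 + x.1 / v ∧ -(x.2 / t) ≤ 1 - x.1 / u) ∧
      (x.2 / s ≤ 1 + x.1 / v ∧ x.2 / s ≤ 1 - x.1 / u) := by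
    intro x
    rw [← le_min_iff, ← le_min_iff, div_le_iff₀ hs, ← neg_div, div_le_iff₀ ht]
    constructor <;> rintro ⟨h1, h2⟩ <;> constructor <;> linarith
  apply Set.Subset.antisymm
  · apply convexHull_min
    · intro x hx
      simp only [Set.mem_ofPred_eq, key]
      simp only [Set.mem_insert_iff, Set.mem_singleton_iff] at hx
      rcases hx with rfl | rfl | rfl | rfl <;> simp [neg_div, div_self, hu.ne', hv.ne', hs.ne', ht.ne'] <;>
        linarith [div_pos hu hv, div_pos hv hu, div_pos hs ht, div_pos ht hs]
    · simp only [key]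
      rintro x ⟨⟨h1, h2⟩, h3, h4⟩ y ⟨⟨k1, k2⟩, k3, k4⟩ a b ha hb hab
      simp only [Set.mem_ofPred_eq, Prod.fst_add, Prod.snd_add, Prod.smul_fst, Prod.smul_snd,
        smul_eq_mul, add_div, mul_div_assoc]
      have e : ∀ {p q r w : ℝ}, p ≤ q → r ≤ w → a * p + b * r ≤ a * q + b * w := by
        intro p q r w h h'
        gcongr
      have := e h1 k1
      have := e h2 k2
      have := e h3 k3
      have := e h4 k4
      refine ⟨⟨?_, ?_⟩, ?_, ?_⟩ <;> linarith
  · rintro ⟨x, y⟩ hx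
    simp only [Set.mem_ofPred_eq, key] at hx
    obtain ⟨⟨h1, h2⟩, h3, h4⟩ := hx
    set S := convexHull ℝ ({(-v, 0), (0, -t), (u, 0), (0, s)} : Set (ℝ × ℝ)) with hSdef
    have hS : Convex ℝ S := convex_convexHull _ _
    have hA : (-v, 0) ∈ S := subset_convexHull _ _ (by simp)
    have hB : (0, -t) ∈ S := subset_convexHull _ _ (by simp)
    have hC : (u, 0) ∈ S := subset_convexHull _ _ (by simp)
    have hD : (0, s) ∈ S := subset_convexHull _ _ (by simp)
    have h0 : (0 : ℝ × ℝ) ∈ S := by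
      have := hS hA hC (a := u / (u + v)) (b := v / (u + v)) (by positivity) (by positivity)
        (by field_simp)
      convert this using 1
      ext <;> simp
      field_simp; ring
    rcases le_total 0 x with hx | hx <;> rcases le_total 0 y with hy | hy
    · convert aux_comb hS h0 hC hD (a := x / u) (b := y / s) (by positivity) (by positivity)
        (by linarith) using 1
      ext <;> simp <;> field_simp
    · convert aux_comb hS h0 hC hB (a := x / u) (b := -y / t) (by positivity)
        (div_nonneg (by linarith) ht.le) (by rw [neg_div]; linarith) using 1
      ext <;> simp <;> field_simp
    · convert aux_comb hS h0 hA hD (a := -x / v) (b := y / s) (div_nonneg (by linarith) hv.le)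
        (by positivity) (by rw [neg_div]; linarith) using 1
      ext <;> simp <;> field_simp
    · convert aux_comb hS h0 hA hB (a := -x / v) (b := -y / t) (div_nonneg (by linarith) hv.le)
        (div_nonneg (by linarith) ht.le) (by rw [neg_div, neg_div]; linarith) using 1
      ext <;> simp <;> field_simp

lemma aux_len {u v : ℝ} (hu : 0 < u) (hv : 0 < v) (huv : u + v = 1) :
    ∫⁻ x : ℝ, ENNReal.ofReal (min (1 + x / v) (1 - x / u)) = ENNReal.ofReal (1 / 2) := by
  have hsup : ∫⁻ x : ℝ, ENNReal.ofReal (min (1 + x / v) (1 - x / u)) =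
      ∫⁻ x in Set.Ioc (-v) u, ENNReal.ofReal (min (1 + x / v) (1 - x / u)) := by
    symm
    apply setLIntegral_eq_of_support_subset
    intro x hx
    simp only [Function.mem_support, ne_eq, ENNReal.ofReal_eq_zero, not_le, lt_min_iff] at hx
    obtain ⟨h1, h2⟩ := hx
    have h1' : -1 < x / v := by linarith
    have h2' : x / u < 1 := by linarith
    rw [lt_div_iff₀ hv] at h1'
    rw [div_lt_one hu] at h2'
    constructor <;> linarith
  have hc : Continuous fun x : ℝ => min (1 + x / v) (1 - x / u) := by fun_prop
  rw [hsup, ← ofReal_integral_eq_lintegral_ofReal]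
  · congr 1
    rw [← intervalIntegral.integral_of_le (by linarith),
      ← intervalIntegral.integral_add_adjacent_intervals (b := 0)
        (hc.intervalIntegrable _ _) (hc.intervalIntegrable _ _)]
    have e1 : ∫ x in (-v)..0, min (1 + x / v) (1 - x / u) = ∫ x in (-v)..0, (1 + x / v) := by
      apply intervalIntegral.integral_congr
      intro x hx
      rw [Set.uIcc_of_le (by linarith)] at hx
      apply min_eq_left
      have := div_nonpos_of_nonpos_of_nonneg hx.2 hu.le
      have := div_nonpos_of_nonpos_of_nonneg hx.2 hv.le
      linarith
    have e2 : ∫ x in (0)..u, min (1 + x / v) (1 - x / u) = ∫ x in (0)..u, (1 - x / u) := by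
      apply intervalIntegral.integral_congr
      intro x hx
      rw [Set.uIcc_of_le (by linarith)] at hx
      apply min_eq_right
      have := div_nonneg hx.1 hu.le
      have := div_nonneg hx.1 hv.le
      linarith
    rw [e1, e2, intervalIntegral.integral_add (by simp)
      (Continuous.intervalIntegrable (by fun_prop) _ _),
      intervalIntegral.integral_sub (by simp)
      (Continuous.intervalIntegrable (by fun_prop) _ _)]
    simp
    field_simp
    linarith
  · exact (hc.integrableOn_Icc (a := -v) (b := u)).mono_set Set.Ioc_subset_Icc_self
  · rw [Filter.EventuallyLE, ae_restrict_iff' measurableSet_Ioc]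
    refine Filter.Eventually.of_forall fun x hx => ?_
    have h1 : -1 ≤ x / v := by rw [le_div_iff₀ hv]; linarith [hx.1]
    have h2 : x / u ≤ 1 := by rw [div_le_one hu]; exact hx.2
    change (0 : ℝ) ≤ min (1 + x / v) (1 - x / u)
    exact le_min (by linarith) (by linarith)

lemma aux_vol {u v s t : ℝ} (hu : 0 < u) (hv : 0 < v) (hs : 0 < s) (ht : 0 < t)
    (huv : u + v = 1) (hst : s + t = 1) :
    volume (convexHull ℝ ({(-v, 0), (0, -t), (u, 0), (0, s)} : Set (ℝ × ℝ))) =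
      ENNReal.ofReal (1 / 2) := by
  rw [aux_hull_s18 hu hv hs ht, ← aux_len hu hv huv, Measure.volume_eq_prod, Measure.prod_apply]
  · apply lintegral_congr
    intro x
    have : (Prod.mk x ⁻¹' {p : ℝ × ℝ | -t * min (1 + p.1 / v) (1 - p.1 / u) ≤ p.2 ∧
        p.2 ≤ s * min (1 + p.1 / v) (1 - p.1 / u)}) =
        Set.Icc (-t * min (1 + x / v) (1 - x / u)) (s * min (1 + x / v) (1 - x / u)) := by
      ext y; simp
    rw [this, Real.volume_Icc]
    congr 1
    rw [← sub_mul, sub_neg_eq_add, hst, one_mul]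
  · apply IsClosed.measurableSet
    have hc : Continuous fun p : ℝ × ℝ => min (1 + p.1 / v) (1 - p.1 / u) := by fun_prop
    exact (isClosed_le (continuous_const.mul hc) continuous_snd).inter
      (isClosed_le continuous_snd (continuous_const.mul hc))

lemma aux_box {u v s t : ℝ} (hu : 0 < u) (hv : 0 < v) (hs : 0 < s) (ht : 0 < t)
    (huv : u + v = 1) (hst : s + t = 1) :
    volume (convexHull ℝ ({(-(2/3*v), -(2/3*t)), (2/3*u, -(2/3*t)), (2/3*u, 2/3*s),
      (-(2/3*v), 2/3*s)} : Set (ℝ × ℝ))) = ENNReal.ofReal (4 / 9) := by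
  have : ({(-(2/3*v), -(2/3*t)), (2/3*u, -(2/3*t)), (2/3*u, 2/3*s),
      (-(2/3*v), 2/3*s)} : Set (ℝ × ℝ)) =
      ({-(2/3*v), 2/3*u} : Set ℝ) ×ˢ ({-(2/3*t), 2/3*s} : Set ℝ) := by
    ext ⟨x, y⟩
    simp only [Set.mem_insert_iff, Set.mem_singleton_iff, Set.mem_prod, Prod.mk.injEq]
    tauto
  rw [this, convexHull_prod, convexHull_pair, convexHull_pair, segment_eq_Icc (by linarith),
    segment_eq_Icc (by linarith), Measure.volume_eq_prod, Measure.prod_prod, Real.volume_Icc,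
    Real.volume_Icc, ← ENNReal.ofReal_mul (by linarith)]
  congr 1
  have h1 : 2/3*u - -(2/3*v) = 2/3 := by linarith
  have h2 : 2/3*s - -(2/3*t) = 2/3 := by linarith
  rw [h1, h2]; norm_num

open scoped Pointwise in
lemma aux_map_s18 (X Y O : E) (hind : LinearIndependent ℝ ![X, Y]) :
    ∃ (f : ℝ × ℝ →ᵃ[ℝ] E) (c : ENNReal), (∀ x y, f (x, y) = O + (x • X + y • Y)) ∧
      ∀ S, volume (f '' S) = c * volume S := by
  let l : ℝ × ℝ →ₗ[ℝ] E :=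
    (LinearMap.toSpanSingleton ℝ E X).coprod (LinearMap.toSpanSingleton ℝ E Y)
  have hl : ∀ x y, l (x, y) = x • X + y • Y := by intro x y; simp [l]
  have hinj : Function.Injective l := by
    rw [injective_iff_map_eq_zero]
    rintro ⟨x, y⟩ h
    rw [hl] at h
    obtain ⟨h1, h2⟩ := LinearIndependent.pair_iff.1 hind x y h
    simp [h1, h2]
  let e : (ℝ × ℝ) ≃L[ℝ] E :=
    (LinearEquiv.ofInjectiveOfFinrankEq l hinj (by simp)).toContinuousLinearEquiv
  have he : ∀ p, e p = l p := fun p => rfl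
  let μ : Measure (ℝ × ℝ) := volume.map e.symm
  have : μ.IsAddHaarMeasure := e.symm.isAddHaarMeasure_map volume
  refine ⟨l.toAffineMap + AffineMap.const ℝ _ O, Measure.addHaarScalarFactor μ volume, ?_, ?_⟩
  · intro x y
    simp [hl, add_comm]
  · intro S
    have h1 : ((l.toAffineMap + AffineMap.const ℝ (ℝ × ℝ) O : ℝ × ℝ →ᵃ[ℝ] E)) '' S = O +ᵥ (e '' S) := by
      rw [← Set.image_vadd, Set.image_image]
      apply Set.image_congr
      intro p _
      simp [he, add_comm]
    have h2 : μ S = volume (e '' S) := by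
      have : μ S = volume (e.symm ⁻¹' S) :=
        e.symm.toHomeomorph.toMeasurableEquiv.map_apply S
      rw [this, e.image_eq_preimage_symm]
    rw [h1, measure_vadd, ← h2]
    exact congrArg (fun m : Measure (ℝ × ℝ) => m S) (Measure.isAddLeftInvariant_eq_smul μ volume)

open MeasureTheory in
/-- **Area of Wittenbauer's parallelogram**: Wittenbauer's parallelogram of a convex
quadrangle (the homothetic parallelogram with ratio `1/3`) has area `8/9` of the
quadrangle. -/
theorem wittenbauer_area (A B C D O : E)
    (hind : LinearIndependent ℝ ![C - A, D - B])
    (hO₁ : O ∈ openSegment ℝ A C) (hO₂ : O ∈ openSegment ℝ B D) :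
    volume (convexHull ℝ
        ({Kpt A B O (1 / 3), Kpt B C O (1 / 3), Kpt C D O (1 / 3), Kpt D A O (1 / 3)} :
          Set E)) =
      ENNReal.ofReal (8 / 9) * volume (convexHull ℝ ({A, B, C, D} : Set E)) := by
  obtain ⟨f, c, hf, hc⟩ := aux_map_s18 (C - A) (D - B) O hind
  obtain ⟨u, v, hu, hv, huv, hO⟩ := hO₁
  obtain ⟨s, t, hs, ht, hst, hO'⟩ := hO₂
  have fA : f (-v, 0) = A := by
    rw [hf, ← hO, eq_sub_iff_add_eq.2 huv]; module
  have fC : f (u, 0) = C := by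
    rw [hf, ← hO, eq_sub_iff_add_eq.2 huv]; module
  have fB : f (0, -t) = B := by
    rw [hf, ← hO', eq_sub_iff_add_eq.2 hst]; module
  have fD : f (0, s) = D := by
    rw [hf, ← hO', eq_sub_iff_add_eq.2 hst]; module
  have h1 : ({A, B, C, D} : Set E) = f '' {(-v, 0), (0, -t), (u, 0), (0, s)} := by
    simp only [Set.image_insert_eq, Set.image_singleton, fA, fB, fC, fD]
  have h2 : ({Kpt A B O (1 / 3), Kpt B C O (1 / 3), Kpt C D O (1 / 3), Kpt D A O (1 / 3)} :
      Set E) = f '' {(-(2/3*v), -(2/3*t)), (2/3*u, -(2/3*t)), (2/3*u, 2/3*s),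
      (-(2/3*v), 2/3*s)} := by
    simp only [Set.image_insert_eq, Set.image_singleton, Kpt]
    rw [← fA, ← fB, ← fC, ← fD]
    simp only [hf]
    congr 1
    · module
    congr 1
    · module
    congr 1
    · module
    congr 1
    module
  rw [h1, h2, ← AffineMap.image_convexHull, ← AffineMap.image_convexHull, hc, hc,
    aux_vol hu hv hs ht huv hst, aux_box hu hv hs ht huv hst, mul_left_comm,
    ← ENNReal.ofReal_mul (by norm_num)]
  norm_num
end
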